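/- Let k and s be integers with k ≥ 2 and s > 2^k. For n ≥ 1 let r(n) denote the number of ordered s-tuples of positive integers (x_1, …, x_s) with x_1^k + x_2^k + … + x_s^k = n. Then for every ε > 0 there exists a constant C > 0 such that for all n ≥ 1, r(n) ≤ C · n^{ s/k − 1 + ε }. -/

import Mathlib

open Finset

/-- The divisor bound. -/
theorem exists_card_divisors_le_rpow {δ : ℝ} (hδ : 0 < δ) :
    ∃ C : ℝ, 0 < C ∧ ∀ n : ℕ, n ≠ 0 → (#n.divisors : ℝ) ≤ C * (n : ℝ) ^ δ := by
  have hL : 0 < Real.log 2 := Real.log_pos (by norm_num)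
  set K : ℝ := 1 + 1 / (δ * Real.log 2) with hK
  have hK1 : 1 ≤ K := by rw [hK]; simp only [le_add_iff_nonneg_right]; positivity
  set M : ℕ := ⌈(2 : ℝ) ^ (1 / δ)⌉₊ with hM
  refine ⟨K ^ M, by positivity, fun n hn => ?_⟩
  have small (p a : ℕ) (hp : 2 ≤ p) : ((a + 1 : ℕ) : ℝ) ≤ K * ((p : ℝ) ^ a) ^ δ := by
    have h2 : ((2 : ℝ) ^ a) ^ δ ≤ ((p : ℝ) ^ a) ^ δ := by
      have : (2 : ℝ) ≤ p := by exact_mod_cast hp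
      gcongr
    have h3 : 1 + Real.log 2 * a * δ ≤ ((2 : ℝ) ^ a) ^ δ := by
      rw [← Real.rpow_natCast, ← Real.rpow_mul (by norm_num), Real.rpow_def_of_pos (by norm_num)]
      linarith [Real.add_one_le_exp (Real.log 2 * (a * δ))]
    have h4 : ((a + 1 : ℕ) : ℝ) ≤ K * (1 + Real.log 2 * a * δ) := by
      have : K * (1 + Real.log 2 * a * δ)
          = 1 + a + (1 / (δ * Real.log 2) + Real.log 2 * a * δ) := by
        rw [hK]; field_simp; ring
      rw [this]; push_cast
      have : 0 ≤ 1 / (δ * Real.log 2) + Real.log 2 * a * δ := by positivity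
      linarith
    calc _ ≤ _ := h4
      _ ≤ _ := by gcongr; exact h3.trans h2
  have large (p a : ℕ) (hp : M ≤ p) : ((a + 1 : ℕ) : ℝ) ≤ ((p : ℝ) ^ a) ^ δ := by
    have h1 : (2 : ℝ) ^ (1 / δ) ≤ p := (Nat.le_ceil _).trans (by exact_mod_cast hp)
    have h2 : (2 : ℝ) ≤ (p : ℝ) ^ δ := by
      have := Real.rpow_le_rpow (by positivity) h1 hδ.le
      rwa [← Real.rpow_mul (by norm_num), one_div_mul_cancel hδ.ne', Real.rpow_one] at this
    have h3 : ((a + 1 : ℕ) : ℝ) ≤ (2 : ℝ) ^ a := by exact_mod_cast Nat.lt_two_pow_self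
    calc _ ≤ _ := h3
      _ ≤ ((p : ℝ) ^ δ) ^ a := by gcongr
      _ = _ := by rw [Real.rpow_pow_comm (by positivity)]
  rw [Nat.card_divisors hn]
  push_cast
  calc ∏ p ∈ n.primeFactors, ((n.factorization p : ℝ) + 1)
      ≤ ∏ p ∈ n.primeFactors,
          (if p < M then K else 1) * ((p : ℝ) ^ n.factorization p) ^ δ := by
        refine prod_le_prod (fun _ _ => by positivity) fun p hp => ?_
        split_ifs with h
        · exact_mod_cast small p _ (Nat.prime_of_mem_primeFactors hp).two_le
        · rw [one_mul]; exact_mod_cast large p _ (not_lt.mp h)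
    _ = K ^ #{p ∈ n.primeFactors | p < M} * (n : ℝ) ^ δ := by
        rw [prod_mul_distrib, prod_ite, prod_const, prod_const_one, mul_one,
          Real.finsetProd_rpow _ _ (fun _ _ => by positivity)]
        congr 2
        conv_rhs => rw [← Nat.prod_factorization_pow_eq_self hn]
        rw [Finsupp.prod]; push_cast; rfl
    _ ≤ K ^ M * (n : ℝ) ^ δ := by
        gcongr
        calc _ ≤ #(range M) := card_le_card fun p hp => by simp at hp ⊢; exact hp.2
          _ = M := card_range M

theorem Int.card_filter_dvd_le (s : Finset ℤ) {m : ℤ} (hm : m ≠ 0) :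
    #{h ∈ s | h ∣ m} ≤ 2 * #m.natAbs.divisors := by
  have : {h ∈ s | h ∣ m} ⊆ m.natAbs.divisors.image (fun d : ℕ => (d : ℤ)) ∪
      m.natAbs.divisors.image (fun d : ℕ => -(d : ℤ)) := by
    intro h hh
    have hd : h.natAbs ∈ m.natAbs.divisors := by
      simpa [Int.natAbs_dvd_natAbs, hm] using (mem_filter.mp hh).2
    rcases Int.natAbs_eq h with h' | h'
    · exact mem_union_left _ (mem_image.mpr ⟨_, hd, h'.symm⟩)
    · exact mem_union_right _ (mem_image.mpr ⟨_, hd, h'.symm⟩)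
  calc _ ≤ _ := card_le_card this
    _ ≤ _ := card_union_le _ _
    _ ≤ _ := by rw [two_mul]; exact add_le_add card_image_le card_image_le

namespace Polynomial

theorem natDegree_taylor_sub_self {p : ℤ[X]} {d : ℕ} (hp : p.natDegree = d + 1) {h : ℤ}
    (hh : h ≠ 0) : (taylor h p - p).natDegree = d := by
  have hp0 : p ≠ 0 := by rintro rfl; simp at hp
  have hlt : (taylor h p - p).degree < p.degree :=
    (degree_sub_lt_left (degree_taylor p h) (by simpa using hp0) (leadingCoeff_taylor ..)).trans_eq
      (degree_taylor p h)
  have hcoeff : (taylor h p - p).coeff d = (d + 1) * p.leadingCoeff * h := by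
    have hdeg : (hasseDeriv d p).natDegree ≤ 1 := by
      rw [natDegree_hasseDeriv, hp]; omega
    rw [coeff_sub, taylor_coeff, eq_X_add_C_of_natDegree_le_one hdeg]
    simp only [hasseDeriv_coeff, eval_add, eval_mul, eval_C, eval_X]
    simp [leadingCoeff, hp, add_comm 1 d]
  refine natDegree_eq_of_le_of_coeff_ne_zero ?_ ?_
  · by_cases h0 : taylor h p - p = 0
    · simp [h0]
    · have := natDegree_lt_natDegree h0 hlt
      omega
  · rw [hcoeff]
    have : p.leadingCoeff ≠ 0 := leadingCoeff_ne_zero.mpr hp0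
    positivity

theorem card_filter_eval_eq_le {p : ℤ[X]} (hp : 1 ≤ p.natDegree) (A : Finset ℤ) (m : ℤ) :
    #{x ∈ A | p.eval x = m} ≤ p.natDegree := by
  have hd : (p - C m).natDegree = p.natDegree := natDegree_sub_C
  have h0 : p - C m ≠ 0 := by
    intro h; rw [h] at hd; simp at hd; omega
  calc _ ≤ #(p - C m).roots.toFinset := card_le_card fun x hx => by
        rw [mem_filter] at hx
        rw [Multiset.mem_toFinset, mem_roots h0]
        simp [hx.2]
    _ ≤ _ := Multiset.toFinset_card_le _
    _ ≤ _ := card_roots' _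
    _ = _ := hd

end Polynomial

section Weyl

open Polynomial

/-- The trigonometric polynomial with frequencies `m` and multiplicities `c m`, at `z`. -/
noncomputable def trigPoly (z : Circle) : (ℤ →₀ ℕ) →ₗ[ℕ] ℂ :=
  Finsupp.linearCombination ℕ fun m : ℤ => ((z ^ m : Circle) : ℂ)

/-- The exponential sum over `A` with phase `p`. -/
noncomputable def expSum (z : Circle) (A : Finset ℤ) (p : ℤ[X]) : ℂ :=
  ∑ x ∈ A, ((z ^ p.eval x : Circle) : ℂ)

@[simp]
theorem trigPoly_single (z : Circle) (m : ℤ) (n : ℕ) :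
    trigPoly z (Finsupp.single m n) = n * ((z ^ m : Circle) : ℂ) := by
  simp [trigPoly]

theorem norm_expSum_le (z : Circle) (A : Finset ℤ) (p : ℤ[X]) : ‖expSum z A p‖ ≤ #A :=
  (norm_sum_le _ _).trans (by rw [sum_congr rfl fun x _ => Circle.norm_coe _]; simp)

theorem card_le_of_subset_Icc {P : ℕ} {A : Finset ℤ} (hA : A ⊆ Icc 1 (P : ℤ)) : #A ≤ P := by
  simpa using card_le_card hA

theorem card_Ioo_neg_le (P : ℕ) : #(Ioo (-(P : ℤ)) P) ≤ 2 * P := by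
  rw [Int.card_Ioo]; omega

/-- Weyl differencing. -/
theorem norm_expSum_sq (z : Circle) {P : ℕ} {A : Finset ℤ} (hA : A ⊆ Icc 1 (P : ℤ)) (p : ℤ[X]) :
    ((‖expSum z A p‖ ^ 2 : ℝ) : ℂ) =
      ∑ h ∈ Ioo (-(P : ℤ)) P, expSum z {x ∈ A | x + h ∈ A} (taylor h p - p) := by
  have h1 : ((‖expSum z A p‖ ^ 2 : ℝ) : ℂ) =
      ∑ x ∈ A, ∑ y ∈ A, ((z ^ (p.eval y - p.eval x) : Circle) : ℂ) := by
    rw [Complex.ofReal_pow, ← Complex.conj_mul', expSum, map_sum, sum_mul_sum]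
    refine sum_congr rfl fun x _ => sum_congr rfl fun y _ => ?_
    rw [← Circle.coe_inv_eq_conj, ← Circle.coe_mul, zpow_sub, mul_comm]
  have h2 (x : ℤ) (hx : x ∈ A) : ∑ y ∈ A, ((z ^ (p.eval y - p.eval x) : Circle) : ℂ) =
      ∑ h ∈ Ioo (-(P : ℤ)) P, if x + h ∈ A then
        ((z ^ (taylor h p - p).eval x : Circle) : ℂ) else 0 := by
    rw [← sum_filter]
    refine sum_bij' (fun y _ => y - x) (fun h _ => x + h) ?_ ?_ ?_ ?_ ?_
    · intro y hy
      have := mem_Icc.mp (hA hx)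
      have := mem_Icc.mp (hA hy)
      simp only [mem_filter, mem_Ioo, add_sub_cancel, hy, and_true]
      omega
    · intro h hh
      exact (mem_filter.mp hh).2
    · intros; ring
    · intros; ring
    · intro y _
      simp [taylor_eval]
  rw [h1, sum_congr rfl h2, sum_comm]
  refine sum_congr rfl fun h _ => ?_
  rw [expSum, sum_filter]

/-- Bounds for the multiplicities of the frequencies `m` that arise after `j` differencing steps
applied to the phase `p` on a subset of `[1, P]`. -/
structure FrequencyBound (j K P : ℕ) (p : ℤ[X]) (c : ℤ →₀ ℕ) : Prop where
  zero : c 0 ≤ K * P ^ j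
  ne_zero : ∀ m ≠ 0, c m ≤ K * (2 * #m.natAbs.divisors) ^ j
  dvd : ∀ a m : ℤ, (∀ x, a ∣ p.eval x) → c m ≠ 0 → a ∣ m

theorem FrequencyBound.zero_steps {P : ℕ} {p : ℤ[X]} (hp : 1 ≤ p.natDegree) (A : Finset ℤ) :
    FrequencyBound 0 p.natDegree P p (∑ x ∈ A, Finsupp.single (p.eval x) 1) := by
  have happ (m : ℤ) : (∑ x ∈ A, Finsupp.single (p.eval x) 1 : ℤ →₀ ℕ) m
      = #{x ∈ A | p.eval x = m} := by
    simp [Finsupp.finsetSum_apply, Finsupp.single_apply]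
  refine ⟨?_, fun m _ => ?_, fun a m ha hm => ?_⟩
  · rw [happ]; simpa using card_filter_eval_eq_le hp A 0
  · rw [happ]; simpa using card_filter_eval_eq_le hp A m
  · rw [happ, ← Nat.pos_iff_ne_zero, card_pos] at hm
    obtain ⟨x, hx⟩ := hm
    rw [← (mem_filter.mp hx).2]
    exact ha x

theorem FrequencyBound.succ {j K P : ℕ} {p : ℤ[X]} {c : ℤ → ℤ →₀ ℕ}
    (hc : ∀ h ∈ (Ioo (-(P : ℤ)) P).erase 0, FrequencyBound j K P (taylor h p - p) (c h)) :
    FrequencyBound (j + 1) (2 * K + 1) P p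
      (Finsupp.single 0 (P ^ (j + 1)) + ∑ h ∈ (Ioo (-(P : ℤ)) P).erase 0, c h) := by
  set H := (Ioo (-(P : ℤ)) P).erase 0 with hH
  have hcard : #H ≤ 2 * P := (card_erase_le).trans (card_Ioo_neg_le P)
  refine ⟨?_, fun m hm => ?_, fun a m ha hm => ?_⟩
  · rw [Finsupp.add_apply, Finsupp.finsetSum_apply, Finsupp.single_eq_same]
    calc _ ≤ P ^ (j + 1) + ∑ h ∈ H, K * P ^ j := by
          gcongr with h hh; exact (hc h hh).zero
      _ ≤ P ^ (j + 1) + 2 * P * (K * P ^ j) := by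
          rw [sum_const, smul_eq_mul]; gcongr
      _ = _ := by ring
  · rw [Finsupp.add_apply, Finsupp.finsetSum_apply, Finsupp.single_eq_of_ne hm, zero_add]
    have hdvd : ∀ h ∈ H, c h m ≠ 0 → h ∣ m := fun h hh hne =>
      (hc h hh).dvd h m (fun x => by
        have := sub_dvd_eval_sub (x + h) x p
        simpa [taylor_eval] using this) hne
    calc ∑ h ∈ H, c h m = ∑ h ∈ H with h ∣ m, c h m := (sum_filter_of_ne hdvd).symm
      _ ≤ ∑ h ∈ H with h ∣ m, K * (2 * #m.natAbs.divisors) ^ j :=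
          sum_le_sum fun h hh => (hc h (mem_filter.mp hh).1).ne_zero m hm
      _ ≤ (2 * #m.natAbs.divisors) * (K * (2 * #m.natAbs.divisors) ^ j) := by
          rw [sum_const, smul_eq_mul]
          gcongr
          exact Int.card_filter_dvd_le H hm
      _ = K * (2 * #m.natAbs.divisors) ^ (j + 1) := by ring
      _ ≤ _ := by gcongr; omega
  · by_cases h0 : m = 0
    · simp [h0]
    rw [Finsupp.add_apply, Finsupp.finsetSum_apply, Finsupp.single_eq_of_ne h0, zero_add] at hm
    obtain ⟨h, hh, hne⟩ := exists_ne_zero_of_sum_ne_zero hm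
    refine (hc h hh).dvd a m (fun x => ?_) hne
    rw [eval_sub, taylor_eval]
    exact dvd_sub (ha _) (ha _)

theorem trigPoly_sum_single (z : Circle) (A : Finset ℤ) (p : ℤ[X]) :
    trigPoly z (∑ x ∈ A, Finsupp.single (p.eval x) 1) = expSum z A p := by
  simp [expSum]

/-- Weyl's inequality, in a form that keeps track of the frequencies. -/
theorem exists_frequencyBound_norm_expSum_pow_le (j d : ℕ) (hd : j + 2 ≤ d) :
    ∃ K : ℕ, ∀ p : ℤ[X], p.natDegree = d → ∀ (P : ℕ) (A : Finset ℤ), A ⊆ Icc 1 (P : ℤ) →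
      ∃ c : ℤ →₀ ℕ, FrequencyBound (j + 1) K P p c ∧ ∀ z : Circle,
        ‖expSum z A p‖ ^ 2 ^ (j + 1) ≤ (2 * P : ℝ) ^ (2 ^ (j + 1) - (j + 2)) * (trigPoly z c).re := by
  induction j generalizing d with
  | zero =>
    refine ⟨2 * (d - 1) + 1, fun p hp P A hA => ?_⟩
    refine ⟨_, FrequencyBound.succ (j := 0)
      (c := fun h => ∑ x ∈ A with x + h ∈ A, Finsupp.single ((taylor h p - p).eval x) 1)
      fun h hh => ?_, fun z => ?_⟩
    · have := natDegree_taylor_sub_self (d := d - 1) (by omega) (ne_of_mem_erase hh) (p := p)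
      rw [← this]
      exact .zero_steps (by omega) _
    · by_cases hP : P = 0
      · have : A = ∅ := by simpa [hP] using hA
        simp [this, expSum, hP]
      have h0 : (0 : ℤ) ∈ Ioo (-(P : ℤ)) P := by simp; omega
      have hsq := congrArg Complex.re (norm_expSum_sq z hA p)
      rw [Complex.ofReal_re, ← add_sum_erase _ _ h0, Complex.add_re] at hsq
      simp only [zero_add, pow_one, Nat.reduceSub, pow_zero, one_mul]
      rw [hsq, map_add, map_sum, Complex.add_re]
      simp only [trigPoly_sum_single]
      refine add_le_add ?_ le_rfl
      calc _ ≤ ‖expSum z {x ∈ A | x + 0 ∈ A} (taylor 0 p - p)‖ := Complex.re_le_norm _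
        _ ≤ _ := norm_expSum_le _ _ _
        _ ≤ P := by exact_mod_cast card_le_of_subset_Icc ((filter_subset _ _).trans hA)
        _ = _ := by simp
  | succ j ih =>
    obtain ⟨K, hK⟩ := ih (d - 1) (by omega)
    refine ⟨2 * K + 1, fun p hp P A hA => ?_⟩
    have hex (h : ℤ) (hh : h ≠ 0) := hK (taylor h p - p)
      (natDegree_taylor_sub_self (by omega) hh) P {x ∈ A | x + h ∈ A} ((filter_subset _ _).trans hA)
    choose! c hc hcz using hex
    refine ⟨_, FrequencyBound.succ fun h hh => hc h (ne_of_mem_erase hh), fun z => ?_⟩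
    by_cases hP : P = 0
    · have : A = ∅ := by simpa [hP] using hA
      simp [this, expSum, hP]
    have hP1 : (1 : ℝ) ≤ P := by exact_mod_cast Nat.one_le_iff_ne_zero.mpr hP
    have h0 : (0 : ℤ) ∈ Ioo (-(P : ℤ)) P := by simp; omega
    set H := Ioo (-(P : ℤ)) P with hH
    have hlt : j + 2 ≤ 2 ^ (j + 1) := Nat.lt_two_pow_self (n := j + 1)
    set t := 2 ^ (j + 1) with ht
    have ht2 : 2 ^ (j + 1 + 1) = 2 * t := by rw [pow_succ]; ring
    set S : ℤ → ℂ := fun h => expSum z {x ∈ A | x + h ∈ A} (taylor h p - p) with hS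
    have hsq : ‖expSum z A p‖ ^ 2 ≤ ∑ h ∈ H, ‖S h‖ := by
      have := congrArg norm (norm_expSum_sq z hA p)
      rw [Complex.norm_real, Real.norm_of_nonneg (by positivity)] at this
      rw [this]
      exact norm_sum_le _ _
    have hS0 : ‖S 0‖ ≤ P := (norm_expSum_le _ _ _).trans
      (by exact_mod_cast card_le_of_subset_Icc ((filter_subset _ _).trans hA))
    have hholder : (∑ h ∈ H, ‖S h‖) ^ t ≤ (2 * P : ℝ) ^ (t - 1) * ∑ h ∈ H, ‖S h‖ ^ t := by
      have hpos : 0 < #H := card_pos.mpr ⟨0, h0⟩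
      have := pow_sum_div_card_le_sum_pow (s := H) (f := fun h => ‖S h‖)
        (fun _ _ => norm_nonneg _) (t - 1)
      rw [Nat.sub_add_cancel (by omega), div_le_iff₀' (by positivity)] at this
      refine this.trans ?_
      gcongr
      exact_mod_cast card_Ioo_neg_le P
    have hsum : ∑ h ∈ H, ‖S h‖ ^ t ≤ (2 * P : ℝ) ^ (t - (j + 2)) *
        ((P : ℝ) ^ (j + 2) + ∑ h ∈ H.erase 0, (trigPoly z (c h)).re) := by
      rw [← add_sum_erase _ _ h0, mul_add, mul_sum]
      gcongr with h hh
      · calc ‖S 0‖ ^ t ≤ (P : ℝ) ^ t := by gcongr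
          _ = (P : ℝ) ^ (t - (j + 2)) * (P : ℝ) ^ (j + 2) := by
            rw [← pow_add]; congr 1; omega
          _ ≤ _ := by gcongr; linarith
      · exact hcz h (ne_of_mem_erase hh) z
    calc ‖expSum z A p‖ ^ 2 ^ (j + 1 + 1) = (‖expSum z A p‖ ^ 2) ^ t := by rw [ht2, pow_mul]
      _ ≤ (∑ h ∈ H, ‖S h‖) ^ t := by gcongr
      _ ≤ _ := hholder
      _ ≤ _ := mul_le_mul_of_nonneg_left hsum (by positivity)
      _ = _ := by
        rw [← mul_assoc, ← pow_add, ht2, map_add, map_sum, Complex.add_re, Complex.re_sum]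
        congr 2
        · omega
        · have hre : ((P : ℂ) ^ (j + 1 + 1)).re = (P : ℝ) ^ (j + 2) := by
            exact_mod_cast Complex.ofReal_re ((P : ℝ) ^ (j + 2))
          simp [hre]

/-- The point `exp(2πiα)` of the unit circle. -/
noncomputable def circleExp (α : ℝ) : Circle := Circle.exp (2 * Real.pi * α)

@[fun_prop]
theorem continuous_circleExp : Continuous circleExp := by
  unfold circleExp; fun_prop

theorem continuous_circleExp_zpow (m : ℤ) :
    Continuous fun α => ((circleExp α ^ m : Circle) : ℂ) :=
  continuous_subtype_val.comp (continuous_circleExp.zpow m)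

theorem integral_circleExp_zpow (m : ℤ) :
    ∫ α in (0 : ℝ)..1, ((circleExp α ^ m : Circle) : ℂ) = if m = 0 then 1 else 0 := by
  split_ifs with hm
  · simp [hm]
  · have h (α : ℝ) : ((circleExp α ^ m : Circle) : ℂ)
        = Complex.exp ((m * (2 * Real.pi * Complex.I)) * α) := by
      rw [Circle.coe_zpow, circleExp, Circle.coe_exp, ← Complex.exp_int_mul]
      congr 1; push_cast; ring
    simp_rw [h]
    rw [integral_exp_mul_complex (by simp [hm, Real.pi_ne_zero])]
    simp [Complex.exp_int_mul_two_pi_mul_I]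

theorem continuous_expSum (A : Finset ℤ) (p : ℤ[X]) :
    Continuous fun α => expSum (circleExp α) A p :=
  continuous_finsetSum _ fun _ _ => continuous_circleExp_zpow _

theorem trigPoly_eq_sum (z : Circle) (c : ℤ →₀ ℕ) :
    trigPoly z c = ∑ m ∈ c.support, (c m : ℂ) * ((z ^ m : Circle) : ℂ) := by
  rw [trigPoly, Finsupp.linearCombination_apply, Finsupp.sum]
  simp only [nsmul_eq_mul]

theorem continuous_trigPoly (c : ℤ →₀ ℕ) : Continuous fun α => trigPoly (circleExp α) c := by
  simp_rw [trigPoly_eq_sum]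
  exact continuous_finsetSum _ fun _ _ => continuous_const.mul (continuous_circleExp_zpow _)

theorem integral_circleExp_zpow_mul_trigPoly (v : ℤ) (c : ℤ →₀ ℕ) :
    ∫ α in (0 : ℝ)..1, ((circleExp α ^ v : Circle) : ℂ) * trigPoly (circleExp α) c = c (-v) := by
  have h (α : ℝ) : ((circleExp α ^ v : Circle) : ℂ) * trigPoly (circleExp α) c =
      ∑ m ∈ c.support, (c m : ℂ) * ((circleExp α ^ (v + m) : Circle) : ℂ) := by
    rw [trigPoly_eq_sum, mul_sum]
    refine sum_congr rfl fun m _ => ?_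
    rw [zpow_add, Circle.coe_mul]; ring
  have hcont (m : ℤ) : Continuous fun α => (c m : ℂ) * ((circleExp α ^ (v + m) : Circle) : ℂ) :=
    continuous_const.mul (continuous_circleExp_zpow _)
  simp_rw [h]
  rw [intervalIntegral.integral_finsetSum fun m _ => (hcont m).intervalIntegrable _ _]
  simp_rw [intervalIntegral.integral_const_mul, integral_circleExp_zpow, add_eq_zero_iff_neg_eq]
  simp +contextual

theorem exists_norm_expSum_pow_eq_sum {A : Finset ℤ} {p : ℤ[X]} {M : ℕ}
    (hM : ∀ x ∈ A, (p.eval x).natAbs ≤ M) (t : ℕ) :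
    ∃ (ι : Type) (_ : Fintype ι) (v : ι → ℤ), (∀ i, (v i).natAbs ≤ 2 * t * M) ∧
      ∀ z, ((‖expSum z A p‖ ^ (2 * t) : ℝ) : ℂ) = ∑ i, ((z ^ v i : Circle) : ℂ) := by
  induction t with
  | zero => exact ⟨Unit, inferInstance, fun _ => 0, by simp, by simp⟩
  | succ t ih =>
    obtain ⟨ι, _, v, hv, hz⟩ := ih
    refine ⟨ι × A × A, inferInstance, fun i => v i.1 + (p.eval i.2.1.1 - p.eval i.2.2.1), ?_, ?_⟩
    · rintro ⟨i, x, y⟩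
      have := hv i
      have := hM x x.2
      have := hM y y.2
      have : 2 * (t + 1) * M = 2 * t * M + M + M := by ring
      dsimp only
      omega
    · intro z
      have hsq : ((‖expSum z A p‖ ^ 2 : ℝ) : ℂ) =
          ∑ x : A × A, ((z ^ (p.eval x.1.1 - p.eval x.2.1) : Circle) : ℂ) := by
        rw [Complex.ofReal_pow, ← Complex.mul_conj', expSum, map_sum, sum_mul_sum,
          Fintype.sum_prod_type, ← sum_coe_sort]
        refine sum_congr rfl fun x _ => ?_
        rw [← sum_coe_sort]
        refine sum_congr rfl fun y _ => ?_
        rw [← Circle.coe_inv_eq_conj, ← Circle.coe_mul, zpow_sub]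
      rw [mul_add, mul_one, pow_add, Complex.ofReal_mul, hz, hsq, sum_mul_sum,
        Fintype.sum_prod_type]
      refine sum_congr rfl fun i _ => sum_congr rfl fun x _ => ?_
      rw [zpow_add, Circle.coe_mul]

theorem integral_norm_expSum_pow_eq_card {A : Finset ℤ} {p : ℤ[X]} {ι : Type} [Fintype ι]
    {v : ι → ℤ} {n : ℕ}
    (hv : ∀ z, ((‖expSum z A p‖ ^ n : ℝ) : ℂ) = ∑ i, ((z ^ v i : Circle) : ℂ)) :
    ∫ α in (0 : ℝ)..1, ‖expSum (circleExp α) A p‖ ^ n = #{i | v i = 0} := by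
  apply Complex.ofReal_injective
  rw [← intervalIntegral.integral_ofReal]
  simp_rw [hv]
  rw [intervalIntegral.integral_finsetSum fun i _ =>
    (continuous_circleExp_zpow _).intervalIntegrable _ _]
  simp_rw [integral_circleExp_zpow]
  simp

theorem integral_norm_expSum_pow_mul_re_trigPoly {A : Finset ℤ} {p : ℤ[X]} {ι : Type} [Fintype ι]
    {v : ι → ℤ} {n : ℕ}
    (hv : ∀ z, ((‖expSum z A p‖ ^ n : ℝ) : ℂ) = ∑ i, ((z ^ v i : Circle) : ℂ)) (c : ℤ →₀ ℕ) :
    ∫ α in (0 : ℝ)..1, ‖expSum (circleExp α) A p‖ ^ n * (trigPoly (circleExp α) c).re =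
      ∑ i, (c (-v i) : ℝ) := by
  have h (α : ℝ) : ‖expSum (circleExp α) A p‖ ^ n * (trigPoly (circleExp α) c).re =
      Complex.reCLM (∑ i, ((circleExp α ^ v i : Circle) : ℂ) * trigPoly (circleExp α) c) := by
    rw [← sum_mul, ← hv, Complex.reCLM_apply, Complex.re_ofReal_mul]
  have hcont (i : ι) : Continuous fun α =>
      ((circleExp α ^ v i : Circle) : ℂ) * trigPoly (circleExp α) c :=
    (continuous_circleExp_zpow _).mul (continuous_trigPoly c)
  simp_rw [h]
  rw [ContinuousLinearMap.intervalIntegral_comp_comm _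
      ((continuous_finsetSum _ fun i _ => hcont i).intervalIntegrable _ _),
    intervalIntegral.integral_finsetSum fun i _ => (hcont i).intervalIntegrable _ _]
  simp_rw [integral_circleExp_zpow_mul_trigPoly]
  simp

theorem exists_two_mul_card_divisors_pow_le (k J T : ℕ) {ε : ℝ} (hε : 0 < ε) :
    ∃ C : ℝ, 0 < C ∧ ∀ P m : ℕ, 1 ≤ P → m ≠ 0 → m ≤ T * P ^ k →
      ((2 * #m.divisors : ℕ) : ℝ) ^ J ≤ C * (P : ℝ) ^ ε := by
  set δ : ℝ := ε / (k * J + 1) with hδ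
  have hδ0 : 0 < δ := by positivity
  obtain ⟨C, hC, h⟩ := exists_card_divisors_le_rpow hδ0
  refine ⟨(2 * (C * (T + 1 : ℝ) ^ δ)) ^ J, by positivity, fun P m hP hm hle => ?_⟩
  have hP1 : (1 : ℝ) ≤ P := by exact_mod_cast hP
  have hmT : (m : ℝ) ≤ (T + 1) * (P : ℝ) ^ k := by
    calc (m : ℝ) ≤ T * (P : ℝ) ^ k := by exact_mod_cast hle
      _ ≤ _ := by gcongr; linarith
  calc ((2 * #m.divisors : ℕ) : ℝ) ^ J = (2 * #m.divisors : ℝ) ^ J := by push_cast; rfl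
    _ ≤ (2 * (C * ((T + 1) * (P : ℝ) ^ k) ^ δ)) ^ J := by
        gcongr
        exact (h m hm).trans (by gcongr)
    _ = (2 * (C * (T + 1 : ℝ) ^ δ)) ^ J * (P : ℝ) ^ (δ * (k * J)) := by
        rw [Real.mul_rpow (by positivity) (by positivity), ← Real.rpow_natCast (P : ℝ) k,
          ← Real.rpow_mul (by positivity), ← mul_assoc, ← mul_assoc, mul_pow,
          ← Real.rpow_mul_natCast (by positivity)]
        congr 2 <;> ring
    _ ≤ _ := by
        gcongr
        rw [hδ, div_mul_eq_mul_div, div_le_iff₀ (by positivity)]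
        gcongr
        linarith

theorem integral_re_trigPoly (c : ℤ →₀ ℕ) :
    ∫ α in (0 : ℝ)..1, (trigPoly (circleExp α) c).re = c 0 := by
  simpa using integral_norm_expSum_pow_mul_re_trigPoly (A := ∅) (p := 0) (n := 0)
    (v := fun _ : Unit => 0) (by simp) c

/-- **Hua's lemma**. -/
theorem hua_lemma (k j : ℕ) (hk : 2 ≤ k) (hj : j + 1 ≤ k) {ε : ℝ} (hε : 0 < ε) :
    ∃ C : ℝ, 0 < C ∧ ∀ P : ℕ, 1 ≤ P →
      (∫ α in (0 : ℝ)..1, ‖expSum (circleExp α) (Icc 1 (P : ℤ)) (X ^ k)‖ ^ 2 ^ (j + 1)) *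
        (P : ℝ) ^ (j + 1) ≤ C * (P : ℝ) ^ 2 ^ (j + 1) * (P : ℝ) ^ ε := by
  have hcontF (P n : ℕ) : Continuous fun α =>
      ‖expSum (circleExp α) (Icc 1 (P : ℤ)) (X ^ k)‖ ^ n :=
    (continuous_expSum _ _).norm.pow n
  have hcontT (c : ℤ →₀ ℕ) : Continuous fun α => (trigPoly (circleExp α) c).re :=
    Complex.continuous_re.comp (continuous_trigPoly c)
  induction j with
  | zero =>
    obtain ⟨K, hK⟩ := exists_frequencyBound_norm_expSum_pow_le 0 k hk
    refine ⟨K + 1, by positivity, fun P hP => ?_⟩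
    have hP1 : (1 : ℝ) ≤ P := by exact_mod_cast hP
    obtain ⟨c, hc, hcz⟩ := hK (X ^ k) (natDegree_X_pow k) P _ subset_rfl
    have hint : ∫ α in (0 : ℝ)..1, ‖expSum (circleExp α) (Icc 1 (P : ℤ)) (X ^ k)‖ ^ 2 ^ (0 + 1)
        ≤ K * P := by
      calc _ ≤ ∫ α in (0 : ℝ)..1, (trigPoly (circleExp α) c).re := by
            refine intervalIntegral.integral_mono zero_le_one
              ((hcontF _ _).intervalIntegrable _ _) ((hcontT c).intervalIntegrable _ _) fun α => ?_
            simpa using hcz (circleExp α)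
        _ = c 0 := integral_re_trigPoly c
        _ ≤ K * P := by exact_mod_cast (by simpa using hc.zero : c 0 ≤ K * P)
    calc _ ≤ (K * P : ℝ) * (P : ℝ) ^ (0 + 1) := by gcongr
      _ = K * (P : ℝ) ^ 2 ^ (0 + 1) * 1 := by ring
      _ ≤ _ := by
        gcongr
        · linarith
        · exact Real.one_le_rpow hP1 hε.le
  | succ j ih =>
    obtain ⟨C', hC', hI⟩ := ih (by omega)
    obtain ⟨K, hK⟩ := exists_frequencyBound_norm_expSum_pow_le j k (by omega)
    have hlt : j + 2 ≤ 2 ^ (j + 1) := Nat.lt_two_pow_self (n := j + 1)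
    have ht2 : 2 ^ (j + 1 + 1) = 2 ^ (j + 1) + 2 ^ (j + 1) := by ring
    have ht : 2 ^ (j + 1) = 2 * 2 ^ j := by ring
    obtain ⟨C₁, hC₁, hdiv⟩ := exists_two_mul_card_divisors_pow_le k (j + 1) (2 ^ (j + 1)) hε
    rw [ht2]
    set t := 2 ^ (j + 1)
    refine ⟨2 ^ t * ((K + 1) * (C' + C₁)), by positivity, fun P hP => ?_⟩
    have hP1 : (1 : ℝ) ≤ P := by exact_mod_cast hP
    specialize hI P hP
    obtain ⟨c, hc, hcz⟩ := hK (X ^ k) (natDegree_X_pow k) P _ subset_rfl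
    obtain ⟨ι, _, v, hvM, hv⟩ := exists_norm_expSum_pow_eq_sum (A := Icc 1 (P : ℤ)) (p := X ^ k)
      (M := P ^ k) (fun x hx => by
        rw [mem_Icc] at hx
        rw [eval_pow, eval_X, Int.natAbs_pow]
        exact Nat.pow_le_pow_left (by omega) k) (2 ^ j)
    rw [← ht] at hvM hv
    have hcard : (Fintype.card ι : ℝ) = (P : ℝ) ^ t := by
      have := hv 1
      simp only [one_zpow, Circle.coe_one, sum_const, card_univ, nsmul_eq_mul, mul_one] at this
      rw [← Complex.ofReal_natCast] at this
      rw [← Complex.ofReal_injective this]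
      simp [expSum]
    have hsum : ∑ i, (c (-v i) : ℝ) ≤ (K + 1) * (C' + C₁) * ((P : ℝ) ^ t * (P : ℝ) ^ ε) := by
      rw [← sum_filter_add_sum_filter_not univ (fun i => v i = 0)]
      have h1 : ∑ i with v i = 0, (c (-v i) : ℝ) ≤ K * (C' * (P : ℝ) ^ t * (P : ℝ) ^ ε) := by
        calc ∑ i with v i = 0, (c (-v i) : ℝ) = ∑ i with v i = 0, (c 0 : ℝ) :=
              sum_congr rfl fun i hi => by rw [(mem_filter.mp hi).2, neg_zero]
          _ = #{i | v i = 0} * (c 0 : ℝ) := by rw [sum_const, nsmul_eq_mul]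
          _ ≤ #{i | v i = 0} * (K * (P : ℝ) ^ (j + 1)) := by
              gcongr; exact_mod_cast hc.zero
          _ = K * (#{i | v i = 0} * (P : ℝ) ^ (j + 1)) := by ring
          _ ≤ _ := by
              rw [integral_norm_expSum_pow_eq_card hv] at hI
              gcongr
      have h2 : ∑ i with ¬ v i = 0, (c (-v i) : ℝ) ≤ (P : ℝ) ^ t * (K * (C₁ * (P : ℝ) ^ ε)) := by
        calc ∑ i with ¬ v i = 0, (c (-v i) : ℝ)
            ≤ ∑ i with ¬ v i = 0, K * (C₁ * (P : ℝ) ^ ε) := by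
              refine sum_le_sum fun i hi => ?_
              have h0 := (mem_filter.mp hi).2
              calc (c (-v i) : ℝ) ≤ K * ((2 * #(-v i).natAbs.divisors : ℕ) : ℝ) ^ (j + 1) := by
                    exact_mod_cast hc.ne_zero (-v i) (neg_ne_zero.mpr h0)
                _ ≤ _ := by
                    gcongr
                    exact hdiv P _ hP (by simpa using h0) (by simpa using hvM i)
          _ ≤ ∑ i : ι, K * (C₁ * (P : ℝ) ^ ε) :=
              sum_le_sum_of_subset_of_nonneg (filter_subset _ _) fun _ _ _ => by positivity
          _ = _ := by rw [sum_const, card_univ, nsmul_eq_mul, hcard]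
      calc _ ≤ _ := add_le_add h1 h2
        _ = K * (C' + C₁) * ((P : ℝ) ^ t * (P : ℝ) ^ ε) := by ring
        _ ≤ _ := by gcongr; linarith
    have hint : ∫ α in (0 : ℝ)..1, ‖expSum (circleExp α) (Icc 1 (P : ℤ)) (X ^ k)‖ ^ (t + t)
        ≤ (2 * P : ℝ) ^ (t - (j + 2)) * ∑ i, (c (-v i) : ℝ) := by
      rw [← integral_norm_expSum_pow_mul_re_trigPoly hv, ← intervalIntegral.integral_const_mul]
      refine intervalIntegral.integral_mono zero_le_one
        ((hcontF _ _).intervalIntegrable _ _)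
        ((continuous_const.mul ((hcontF _ _).mul (hcontT c))).intervalIntegrable _ _) fun α => ?_
      dsimp only
      rw [pow_add, mul_left_comm]
      exact mul_le_mul_of_nonneg_left (hcz _) (by positivity)
    calc _ ≤ ((2 * P : ℝ) ^ (t - (j + 2)) *
          ((K + 1) * (C' + C₁) * ((P : ℝ) ^ t * (P : ℝ) ^ ε))) * (P : ℝ) ^ (j + 2) := by
          gcongr
          exact hint.trans (by gcongr)
      _ ≤ ((2 * P : ℝ) ^ (t - (j + 2)) *
          ((K + 1) * (C' + C₁) * ((P : ℝ) ^ t * (P : ℝ) ^ ε))) * (2 * P : ℝ) ^ (j + 2) := by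
          gcongr; linarith
      _ = (2 * P : ℝ) ^ (t - (j + 2) + (j + 2)) *
          ((K + 1) * (C' + C₁) * ((P : ℝ) ^ t * (P : ℝ) ^ ε)) := by rw [pow_add]; ring
      _ = _ := by rw [Nat.sub_add_cancel hlt, mul_pow, pow_add]; ring

theorem card_filter_sum_eval_eq_le_integral (A : Finset ℤ) (p : ℤ[X]) (s : ℕ) (n : ℤ) :
    (#{x ∈ Fintype.piFinset fun _ : Fin s => A | ∑ i, p.eval (x i) = n} : ℝ) ≤
      ∫ α in (0 : ℝ)..1, ‖expSum (circleExp α) A p‖ ^ s := by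
  have hexp (z : Circle) : expSum z A p ^ s * ((z ^ (-n) : Circle) : ℂ) =
      ∑ x ∈ Fintype.piFinset fun _ : Fin s => A, ((z ^ (∑ i, p.eval (x i) - n) : Circle) : ℂ) := by
    rw [expSum, sum_pow', sum_mul]
    refine sum_congr rfl fun x _ => ?_
    have hprod : ∀ S : Finset (Fin s), ∏ i ∈ S, ((z ^ p.eval (x i) : Circle) : ℂ) =
        ((z ^ (∑ i ∈ S, p.eval (x i)) : Circle) : ℂ) := fun S => by
      induction S using Finset.induction_on with
      | empty => simp
      | insert i S hi ih => rw [prod_insert hi, sum_insert hi, ih, zpow_add, Circle.coe_mul]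
    rw [hprod, sub_eq_add_neg, zpow_add, Circle.coe_mul]
  have hint : ∫ α in (0 : ℝ)..1, expSum (circleExp α) A p ^ s * ((circleExp α ^ (-n) : Circle) : ℂ)
      = #{x ∈ Fintype.piFinset fun _ : Fin s => A | ∑ i, p.eval (x i) = n} := by
    simp_rw [hexp]
    rw [intervalIntegral.integral_finsetSum fun i _ =>
      (continuous_circleExp_zpow _).intervalIntegrable _ _]
    simp_rw [integral_circleExp_zpow, sub_eq_zero]
    simp
  have := congrArg norm hint
  rw [Complex.norm_natCast] at this
  rw [← this]
  refine (intervalIntegral.norm_integral_le_integral_norm zero_le_one).trans_eq ?_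
  simp_rw [norm_mul, norm_pow, Circle.norm_coe, mul_one]

theorem ncard_setOf_sum_pow_eq_le_integral {k s n P : ℕ} (hk : k ≠ 0) (hP : n ≤ P ^ k) :
    ({x : Fin s → ℕ | (∀ i, 0 < x i) ∧ ∑ i, x i ^ k = n}.ncard : ℝ) ≤
      ∫ α in (0 : ℝ)..1, ‖expSum (circleExp α) (Icc 1 (P : ℤ)) (X ^ k)‖ ^ s := by
  refine le_trans ?_ (card_filter_sum_eval_eq_le_integral (Icc 1 (P : ℤ)) (X ^ k) s n)
  rw [← Set.ncard_coe_finset, Nat.cast_le]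
  refine Set.ncard_le_ncard_of_injOn (fun x i => (x i : ℤ)) ?_ ?_ (finite_toSet _)
  · rintro x ⟨hpos, hsum⟩
    simp only [coe_filter, Fintype.mem_piFinset, mem_Icc, eval_pow, eval_X, Set.mem_ofPred_eq]
    refine ⟨fun i => ⟨by exact_mod_cast hpos i, ?_⟩, by exact_mod_cast hsum⟩
    have : x i ^ k ≤ P ^ k :=
      ((single_le_sum (f := fun i => x i ^ k) (fun _ _ => Nat.zero_le _) (mem_univ i)).trans_eq
        hsum).trans hP
    exact_mod_cast (Nat.pow_le_pow_iff_left hk).mp this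
  · intro x _ y _ hxy
    funext i
    exact Int.ofNat_injective (congrFun hxy i)

end Weyl

theorem stmt_18 (k s : ℕ) (hk : 2 ≤ k) (hs : 2 ^ k < s) :
    ∀ ε : ℝ, 0 < ε → ∃ C : ℝ, 0 < C ∧ ∀ n : ℕ, 1 ≤ n →
      (({x : Fin s → ℕ | (∀ i, 0 < x i) ∧ ∑ i, x i ^ k = n}.ncard : ℝ)) ≤
        C * (n : ℝ) ^ ((s : ℝ) / k - 1 + ε) := by
  intro ε hε
  have hk0 : (0 : ℝ) < k := by exact_mod_cast (by omega : 0 < k)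
  have hks : k ≤ s := (Nat.lt_two_pow_self.trans hs).le
  have hksR : (k : ℝ) ≤ s := by exact_mod_cast hks
  have hεk : 0 < k * ε := by positivity
  obtain ⟨C, hC, hHua⟩ := hua_lemma k (k - 1) hk (by omega) hεk
  rw [Nat.sub_add_cancel (by omega)] at hHua
  refine ⟨C * 2 ^ ((s : ℝ) - k + k * ε), by positivity, fun n hn => ?_⟩
  have hn1 : (1 : ℝ) ≤ n := by exact_mod_cast hn
  have hroot1 : 1 ≤ (n : ℝ) ^ (1 / k : ℝ) := Real.one_le_rpow hn1 (by positivity)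
  set P := ⌈(n : ℝ) ^ (1 / k : ℝ)⌉₊ with hP
  have hle : (n : ℝ) ^ (1 / k : ℝ) ≤ P := Nat.le_ceil _
  have hP1R : (1 : ℝ) ≤ P := hroot1.trans hle
  have hP1 : 1 ≤ P := by exact_mod_cast hP1R
  have hPle : (P : ℝ) ≤ 2 * (n : ℝ) ^ (1 / k : ℝ) := by
    linarith [Nat.ceil_lt_add_one (zero_le_one.trans hroot1)]
  have hnP : n ≤ P ^ k := by
    have : (n : ℝ) ≤ (P : ℝ) ^ k := by
      calc (n : ℝ) = ((n : ℝ) ^ (1 / k : ℝ)) ^ k := by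
            rw [one_div, Real.rpow_inv_natCast_pow (by positivity) (by omega)]
        _ ≤ _ := by gcongr
    exact_mod_cast this
  have hcont := continuous_expSum (Icc 1 (P : ℤ)) (Polynomial.X ^ k)
  have hint : ∫ α in (0 : ℝ)..1,
        ‖expSum (circleExp α) (Icc 1 (P : ℤ)) (Polynomial.X ^ k)‖ ^ s ≤ (P : ℝ) ^ (s - 2 ^ k) *
      ∫ α in (0 : ℝ)..1, ‖expSum (circleExp α) (Icc 1 (P : ℤ)) (Polynomial.X ^ k)‖ ^ 2 ^ k := by
    rw [← intervalIntegral.integral_const_mul]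
    refine intervalIntegral.integral_mono zero_le_one
      ((hcont.norm.pow _).intervalIntegrable _ _)
      ((continuous_const.mul (hcont.norm.pow _)).intervalIntegrable _ _) fun α => ?_
    dsimp only
    rw [← Nat.sub_add_cancel hs.le, pow_add, Nat.add_sub_cancel]
    gcongr
    exact (norm_expSum_le _ _ _).trans (by exact_mod_cast card_le_of_subset_Icc subset_rfl)
  have hr := (ncard_setOf_sum_pow_eq_le_integral (s := s) (by omega) hnP).trans hint
  set r : ℝ := ({x : Fin s → ℕ | (∀ i, 0 < x i) ∧ ∑ i, x i ^ k = n}.ncard : ℝ)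
  have hrP : r * (P : ℝ) ^ k ≤ C * (P : ℝ) ^ s * (P : ℝ) ^ (k * ε) := by
    calc r * (P : ℝ) ^ k ≤ _ := mul_le_mul_of_nonneg_right hr (by positivity)
      _ ≤ (P : ℝ) ^ (s - 2 ^ k) * (C * (P : ℝ) ^ 2 ^ k * (P : ℝ) ^ (k * ε)) := by
          rw [mul_assoc]
          exact mul_le_mul_of_nonneg_left (hHua P hP1) (by positivity)
      _ = C * (P : ℝ) ^ (s - 2 ^ k + 2 ^ k) * (P : ℝ) ^ (k * ε) := by rw [pow_add]; ring
      _ = _ := by rw [Nat.sub_add_cancel hs.le]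
  calc r ≤ C * (P : ℝ) ^ s * (P : ℝ) ^ (k * ε) / (P : ℝ) ^ k := (le_div_iff₀ (by positivity)).mpr hrP
    _ = C * (P : ℝ) ^ ((s : ℝ) - k + k * ε) := by
        rw [Real.rpow_add (by positivity), Real.rpow_sub (by positivity), Real.rpow_natCast,
          Real.rpow_natCast]
        ring
    _ ≤ C * (2 * (n : ℝ) ^ (1 / k : ℝ)) ^ ((s : ℝ) - k + k * ε) := by
        gcongr
    _ = C * 2 ^ ((s : ℝ) - k + k * ε) * (n : ℝ) ^ ((s : ℝ) / k - 1 + ε) := by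
        rw [Real.mul_rpow (by norm_num) (by positivity), ← Real.rpow_mul (by positivity), mul_assoc]
        congr 3
        field_simp
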